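/- SURE unbiasedness in the iid Gaussian model: under the hypotheses of Stein's identity, the quantity S(h) = ‖θ‖² + ‖h(X)‖² + 2σ²·∑ᵢ ∂hᵢ(X)/∂xᵢ - 2⟨h(X), X⟩ satisfies E[S(h)] = E[‖h(X) - θ‖²], i.e., S(h) is an unbiased estimate of the MSE (with ‖θ‖² treated as a constant). -/

import Mathlib

open Real MeasureTheory Filter

lemma aux_sqrt_deriv {g : ℝ → ℝ} {g' t : ℝ} (hg : HasDerivAt g g' t) :
    HasDerivAt (fun t => √(1 + g t ^ 2)) (g t * g' / √(1 + g t ^ 2)) t := by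
  have h1 : HasDerivAt (fun t => 1 + g t ^ 2) (2 * g t * g') t := by
    have := (hg.pow 2).const_add 1
    convert! this using 1
    simp
  convert! h1.sqrt (by positivity) using 1
  have : √(1 + g t ^ 2) ≠ 0 := by positivity
  field_simp

lemma stein_pointwise (s2 u g g' : ℝ) (hs : 0 < s2) :
    |u| * |g| ≤ (s2 + 1) * (1 + |g|) + s2 * |g'| -
      s2 * ((√(1 + u ^ 2) - u * (u * 1 / √(1 + u ^ 2))) / √(1 + u ^ 2) ^ 2 * √(1 + g ^ 2)
        + u / √(1 + u ^ 2) * (g * g' / √(1 + g ^ 2)))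
      + u / √(1 + u ^ 2) * √(1 + g ^ 2) * u := by
  set r := √(1 + u ^ 2) with hr
  set v := √(1 + g ^ 2) with hv
  have hr2 : r ^ 2 = 1 + u ^ 2 := Real.sq_sqrt (by positivity)
  have hv2 : v ^ 2 = 1 + g ^ 2 := Real.sq_sqrt (by positivity)
  have hr0 : 0 < r := by positivity
  have hv0 : 0 < v := by positivity
  have hr1 : 1 ≤ r := by nlinarith [sq_nonneg u]
  have hur : |u| ≤ r := abs_le_of_sq_le_sq (by nlinarith) hr0.le
  have hgv : |g| ≤ v := abs_le_of_sq_le_sq (by nlinarith) hv0.le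
  have hvg : v ≤ 1 + |g| := by
    refine (pow_le_pow_iff_left₀ hv0.le (by positivity) two_ne_zero).1 ?_
    nlinarith [abs_nonneg g, sq_abs g]
  have e1 : (r - u * (u * 1 / r)) / r ^ 2 ≤ 1 := by
    rw [div_le_one (by positivity)]
    have : u * (u * 1 / r) = u ^ 2 / r := by ring
    have : 0 ≤ u ^ 2 / r := by positivity
    nlinarith
  have e2 : (u / r * (g * g' / v)) ≤ |g'| := by
    refine (le_abs_self _).trans ?_
    rw [abs_mul, abs_div, abs_div, abs_mul, abs_of_pos hr0, abs_of_pos hv0]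
    have a1 : |u| / r ≤ 1 := by rw [div_le_one hr0]; exact hur
    have a2 : |g| * |g'| / v ≤ |g'| := by
      rw [div_le_iff₀ hv0]; nlinarith [abs_nonneg g']
    calc |u| / r * (|g| * |g'| / v) ≤ 1 * |g'| := by gcongr
      _ = _ := one_mul _
  have e3 : |u| ≤ u / r * u + 1 := by
    have : u / r * u = r - 1 / r := by field_simp; linarith
    have : 1 / r ≤ 1 := by rw [div_le_one hr0]; exact hr1
    linarith
  have e4 : |u| * |g| ≤ u / r * v * u + v := by
    calc |u| * |g| ≤ |u| * v := by gcongr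
      _ ≤ (u / r * u + 1) * v := by gcongr
      _ = _ := by ring
  have e5 : s2 * ((r - u * (u * 1 / r)) / r ^ 2 * v) ≤ s2 * (1 + |g|) := by
    gcongr
    nlinarith
  have e6 := mul_le_mul_of_nonneg_left e2 hs.le
  have e7 := mul_add s2 ((r - u * (u * 1 / r)) / r ^ 2 * v) (u / r * (g * g' / v))
  linarith

lemma stein_one (s2 : ℝ) (hs : 0 < s2) (a : ℝ) (g g' φ : ℝ → ℝ)
    (hg : ∀ t, HasDerivAt g (g' t) t) (hg' : Continuous g')
    (hφ : ∀ t, HasDerivAt φ (-((t - a) / s2) * φ t) t) (hφ0 : ∀ t, 0 ≤ φ t)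
    (iK : Integrable (fun t => (s2 + 1) * (φ t + |g t| * φ t) + s2 * (|g' t| * φ t))) :
    Integrable (fun t => g t * (t - a) * φ t) ∧
      ∫ t, ‖g t * (t - a) * φ t‖ ≤
        ∫ t, ((s2 + 1) * (φ t + |g t| * φ t) + s2 * (|g' t| * φ t)) := by
  have cg : Continuous g := continuous_iff_continuousAt.2 fun t => (hg t).continuousAt
  have cφ : Continuous φ := continuous_iff_continuousAt.2 fun t => (hφ t).continuousAt
  have r0 : ∀ t, √(1 + (t - a) ^ 2) ≠ 0 := fun t => by positivity
  have v0 : ∀ t, √(1 + g t ^ 2) ≠ 0 := fun t => by positivity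
  let F : ℝ → ℝ := fun t => (t - a) / √(1 + (t - a) ^ 2) * √(1 + g t ^ 2) * φ t
  let F' : ℝ → ℝ := fun t =>
    ((1 * √(1 + (t - a) ^ 2) - (t - a) * ((t - a) * 1 / √(1 + (t - a) ^ 2))) /
      √(1 + (t - a) ^ 2) ^ 2 * √(1 + g t ^ 2)
      + (t - a) / √(1 + (t - a) ^ 2) * (g t * g' t / √(1 + g t ^ 2))) * φ t
      + (t - a) / √(1 + (t - a) ^ 2) * √(1 + g t ^ 2) * (-((t - a) / s2) * φ t)
  have hF : ∀ t, HasDerivAt F (F' t) t := fun t => by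
    have h1 : HasDerivAt (fun t => t - a) 1 t := (hasDerivAt_id t).sub_const a
    exact ((h1.div (aux_sqrt_deriv h1) (r0 t)).mul (aux_sqrt_deriv (hg t))).mul (hφ t)
  have cF' : Continuous F' := by
    have r0' : ∀ t, √(1 + (t - a) ^ 2) ^ 2 ≠ 0 := fun t => pow_ne_zero _ (r0 t)
    fun_prop (disch := assumption)
  have cq : Continuous (fun t => g t * (t - a) * φ t) := by fun_prop
  have cK : Continuous (fun t => (s2 + 1) * (φ t + |g t| * φ t) + s2 * (|g' t| * φ t)) := by
    fun_prop
  have pw : ∀ t, ‖g t * (t - a) * φ t‖ ≤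
      ((s2 + 1) * (φ t + |g t| * φ t) + s2 * (|g' t| * φ t)) - s2 * F' t := fun t => by
    have := mul_le_mul_of_nonneg_right (stein_pointwise s2 (t - a) (g t) (g' t) hs) (hφ0 t)
    rw [norm_mul, norm_mul, Real.norm_eq_abs, Real.norm_eq_abs, Real.norm_eq_abs,
      abs_of_nonneg (hφ0 t)]
    refine (le_of_eq (by ring)).trans (this.trans (le_of_eq ?_))
    simp only [F']
    have : s2 * ((t - a) / √(1 + (t - a) ^ 2) * √(1 + g t ^ 2) * (-((t - a) / s2) * φ t))
      = - ((t - a) / √(1 + (t - a) ^ 2) * √(1 + g t ^ 2) * (t - a) * φ t) := by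
      field_simp
    rw [mul_add s2 _ ((t - a) / √(1 + (t - a) ^ 2) * √(1 + g t ^ 2) * (-((t - a) / s2) * φ t)),
      this]
    ring
  have K0 : ∀ t, 0 ≤ (s2 + 1) * (φ t + |g t| * φ t) + s2 * (|g' t| * φ t) := fun t => by
    have := hφ0 t
    positivity
  have bd : ∀ R : ℝ, 0 ≤ R → ∫ t in (a - R)..(a + R), ‖g t * (t - a) * φ t‖ ≤
      ∫ t, ((s2 + 1) * (φ t + |g t| * φ t) + s2 * (|g' t| * φ t)) := fun R hR => by
    calc ∫ t in (a - R)..(a + R), ‖g t * (t - a) * φ t‖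
        ≤ ∫ t in (a - R)..(a + R),
          (((s2 + 1) * (φ t + |g t| * φ t) + s2 * (|g' t| * φ t)) - s2 * F' t) :=
          intervalIntegral.integral_mono (by linarith) (cq.norm.intervalIntegrable _ _)
            ((cK.sub (cF'.const_mul s2)).intervalIntegrable _ _) pw
      _ = (∫ t in (a - R)..(a + R), ((s2 + 1) * (φ t + |g t| * φ t) + s2 * (|g' t| * φ t)))
          - s2 * (F (a + R) - F (a - R)) := by
          rw [intervalIntegral.integral_sub (cK.intervalIntegrable _ _)
            ((cF'.const_mul s2).intervalIntegrable _ _), intervalIntegral.integral_const_mul,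
            intervalIntegral.integral_eq_sub_of_hasDerivAt (fun t _ => hF t)
              (cF'.intervalIntegrable _ _)]
      _ ≤ ∫ t in (a - R)..(a + R), ((s2 + 1) * (φ t + |g t| * φ t) + s2 * (|g' t| * φ t)) := by
          have h1 : 0 ≤ F (a + R) := by
            have := hφ0 (a + R)
            simp only [F, add_sub_cancel_left]
            positivity
          have h2 : F (a - R) ≤ 0 := by
            have := hφ0 (a - R)
            have e : F (a - R) = -(R / √(1 + R ^ 2) * √(1 + g (a - R) ^ 2) * φ (a - R)) := by
              simp only [F, sub_sub_cancel_left, neg_sq]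
              ring
            rw [e, neg_nonpos]
            positivity
          nlinarith
      _ ≤ _ := by
          rw [intervalIntegral.integral_of_le (by linarith)]
          exact setIntegral_le_integral iK (Eventually.of_forall K0)
  have ta : Tendsto (fun R : ℝ => a - R) atTop atBot :=
    tendsto_atBot_add_const_left _ a tendsto_neg_atTop_atBot
  have tb : Tendsto (fun R : ℝ => a + R) atTop atTop :=
    tendsto_atTop_add_const_left _ a tendsto_id
  have bd' : ∀ᶠ R : ℝ in atTop, ∫ t in (a - R)..(a + R), ‖g t * (t - a) * φ t‖ ≤
      ∫ t, ((s2 + 1) * (φ t + |g t| * φ t) + s2 * (|g' t| * φ t)) := by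
    filter_upwards [eventually_ge_atTop 0] with R hR using bd R hR
  have iq : Integrable (fun t => g t * (t - a) * φ t) :=
    integrable_of_intervalIntegral_norm_bounded _
      (fun R => cq.integrableOn_Ioc) ta tb bd'
  exact ⟨iq, le_of_tendsto (intervalIntegral_tendsto_integral iq.norm ta tb) bd'⟩

/-- One-coordinate Stein identity. -/
lemma stein_coord (n : ℕ) (s2 : ℝ) (hs : 0 < s2) (a : ℝ) (i : Fin (n + 1))
    (f G d : (Fin (n + 1) → ℝ) → ℝ) (f0 : ∀ x, 0 ≤ f x) (fi : Integrable f)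
    (cf : Continuous f) (cG : Continuous G) (cd : Continuous d)
    (hf : ∀ t y, HasDerivAt (fun t => f (i.insertNth t y))
      (-((t - a) / s2) * f (i.insertNth t y)) t)
    (hG : ∀ t y, HasDerivAt (fun t => G (i.insertNth t y)) (d (i.insertNth t y)) t)
    (i1 : Integrable (fun x => |G x| * f x)) (i2 : Integrable (fun x => |d x| * f x))
    (hb : ∀ y, Tendsto (fun t => G (i.insertNth t y) * f (i.insertNth t y)) atBot (nhds 0))
    (ht : ∀ y, Tendsto (fun t => G (i.insertNth t y) * f (i.insertNth t y)) atTop (nhds 0)) :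
    Integrable (fun x => s2 * (d x * f x) - G x * (x i - a) * f x) ∧
      ∫ x, (s2 * (d x * f x) - G x * (x i - a) * f x) = 0 := by
  let e := (MeasurableEquiv.piFinSuccAbove (fun _ => ℝ) i).symm
  have he : MeasurePreserving e (volume.prod volume) volume :=
    (volume_preserving_piFinSuccAbove (fun _ => ℝ) i).symm _
  have hei : ∀ H : (Fin (n + 1) → ℝ) → ℝ, Integrable (fun z => H (e z)) (volume.prod volume) ↔
    Integrable H := fun H => he.integrable_comp_emb e.measurableEmbedding
  have hev : ∀ z, e z = i.insertNth z.1 z.2 := fun z => rfl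
  have iK : Integrable (fun x => (s2 + 1) * (f x + |G x| * f x) + s2 * (|d x| * f x)) :=
    ((fi.add i1).const_mul _).add (i2.const_mul _)
  have iK' := (hei _).2 iK
  have one : ∀ᵐ y : Fin n → ℝ, Integrable (fun t => G (e (t, y)) * (e (t, y) i - a) * f (e (t, y))) ∧
      ∫ t, ‖G (e (t, y)) * (e (t, y) i - a) * f (e (t, y))‖ ≤
      ∫ t, ((s2 + 1) * (f (e (t, y)) + |G (e (t, y))| * f (e (t, y)))
        + s2 * (|d (e (t, y))| * f (e (t, y)))) := by
    filter_upwards [iK'.prod_left_ae] with y hy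
    have ce : Continuous (fun t : ℝ => (i.insertNth t y : Fin (n + 1) → ℝ)) := by fun_prop
    have := stein_one s2 hs a (fun t => G (e (t, y))) (fun t => d (e (t, y)))
      (fun t => f (e (t, y))) (fun t => hG t y) (cd.comp ce) (fun t => hf t y) (fun t => f0 _) hy
    simpa [hev] using this
  have cq : Continuous (fun x => G x * (x i - a) * f x) := by fun_prop
  have iq' : Integrable (fun z => G (e z) * (e z i - a) * f (e z)) (volume.prod volume) := by
    have am : AEStronglyMeasurable (fun z => G (e z) * (e z i - a) * f (e z))
        (volume.prod volume) := 
      (cq.measurable.comp e.measurable).aestronglyMeasurable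
    rw [integrable_prod_iff' am]
    refine ⟨one.mono fun y hy => hy.1, ?_⟩
    refine iK'.integral_prod_right.mono' am.norm.prod_swap.integral_prod_right' ?_
    filter_upwards [one] with y hy
    rw [Real.norm_of_nonneg (integral_nonneg fun _ => norm_nonneg _)]
    exact hy.2
  have iq : Integrable (fun x => G x * (x i - a) * f x) := (hei _).1 iq'
  have id0 : Integrable (fun x => d x * f x) := by
    refine i2.mono (cd.mul cf).aestronglyMeasurable (Eventually.of_forall fun x => ?_)
    simp
  have iD : Integrable (fun x => s2 * (d x * f x) - G x * (x i - a) * f x) :=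
    (id0.const_mul _).sub iq
  refine ⟨iD, ?_⟩
  have iD' := (hei _).2 iD
  rw [← he.integral_comp e.measurableEmbedding, integral_prod_symm _ iD']
  refine integral_eq_zero_of_ae ?_
  filter_upwards [iD'.prod_left_ae] with y hy
  have key := integral_of_hasDerivAt_of_tendsto
    (f := fun t => s2 * (G (i.insertNth t y) * f (i.insertNth t y)))
    (f' := fun t => s2 * (d (e (t, y)) * f (e (t, y))) -
      G (e (t, y)) * (e (t, y) i - a) * f (e (t, y))) (fun t => by
        convert! ((hG t y).mul (hf t y)).const_mul s2 using 1
        simp only [hev, Fin.insertNth_apply_same]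
        field_simp
        ring) hy ((hb y).const_mul s2) ((ht y).const_mul s2)
  simpa using key

theorem sure_unbiased_iid_gaussian (m : ℕ) (σ : ℝ) (hσ : 0 < σ) (θ : Fin m → ℝ)
    (f : (Fin m → ℝ) → ℝ)
    (hf : ∀ x, f x = ∏ i, ((2 * π * σ ^ 2) ^ (-(1 : ℝ) / 2) *
      Real.exp (-(x i - θ i) ^ 2 / (2 * σ ^ 2))))
    (h : (Fin m → ℝ) → (Fin m → ℝ))
    (hh : ContDiff ℝ 1 h)
    (hint1 : ∀ i, Integrable (fun x => |h x i| * f x))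
    (hint2 : ∀ i, Integrable
      (fun x => |deriv (fun t => h (Function.update x i t) i) (x i)| * f x))
    (hdecay : ∀ i x, Tendsto
      (fun t : ℝ => h (Function.update x i t) i * f (Function.update x i t))
      (atBot ⊔ atTop) (nhds 0))
    (S : (Fin m → ℝ) → ℝ)
    (hS : ∀ x, S x = (∑ i, (θ i) ^ 2) + (∑ i, (h x i) ^ 2)
      + 2 * σ ^ 2 * (∑ i, deriv (fun t => h (Function.update x i t) i) (x i))
      - 2 * ∑ i, h x i * x i) :
    ∫ x, S x * f x = ∫ x, (∑ i, (h x i - θ i) ^ 2) * f x := by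
  have s0 : 0 < σ ^ 2 := by positivity
  have hsq : (0 : ℝ) < 2 * π * σ ^ 2 := by positivity
  have f0 : ∀ x, 0 ≤ f x := fun x => by
    rw [hf]
    exact Finset.prod_nonneg fun i _ => by positivity
  have hf' : f = fun x => ∏ i, ((2 * π * σ ^ 2) ^ (-(1 : ℝ) / 2) *
      Real.exp (-(x i - θ i) ^ 2 / (2 * σ ^ 2))) := funext hf
  have cf : Continuous f := by rw [hf']; fun_prop
  have fi : Integrable f := by
    rw [hf']
    refine Integrable.fintype_prod (f := fun i t => (2 * π * σ ^ 2) ^ (-(1 : ℝ) / 2) *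
      Real.exp (-(t - θ i) ^ 2 / (2 * σ ^ 2))) fun i => ?_
    have := ((integrable_exp_neg_mul_sq (b := 1 / (2 * σ ^ 2)) (by positivity)).comp_sub_right
      (θ i)).const_mul ((2 * π * σ ^ 2) ^ (-(1 : ℝ) / 2))
    refine this.congr (Eventually.of_forall fun t => ?_)
    simp only
    congr 2
    ring
  have key : ∀ i, Integrable (fun x => σ ^ 2 *
        (deriv (fun t => h (Function.update x i t) i) (x i) * f x) - h x i * (x i - θ i) * f x) ∧
      ∫ x, (σ ^ 2 * (deriv (fun t => h (Function.update x i t) i) (x i) * f x)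
        - h x i * (x i - θ i) * f x) = 0 := by
    intro i
    have hder : ∀ x t, HasDerivAt (fun t => h (Function.update x i t) i)
        (fderiv ℝ h (Function.update x i t) (Pi.single i 1) i) t := fun x t => by
      have h1 := ((hh.differentiable one_ne_zero) (Function.update x i t)).hasFDerivAt
      have h2 := h1.comp_hasDerivAt t (hasDerivAt_update x i t)
      exact (hasDerivAt_pi.1 h2) i
    have dd : ∀ x, deriv (fun t => h (Function.update x i t) i) (x i) =
        fderiv ℝ h x (Pi.single i 1) i := fun x => by
      rw [(hder x (x i)).deriv, Function.update_eq_self]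
    have cd : Continuous (fun x => deriv (fun t => h (Function.update x i t) i) (x i)) := by
      simp_rw [dd]
      have := hh.continuous_fderiv one_ne_zero
      fun_prop
    cases m with
    | zero => exact i.elim0
    | succ n =>
    have up : ∀ (y : Fin n → ℝ) (t : ℝ), (i.insertNth t y : Fin (n + 1) → ℝ) =
      Function.update (i.insertNth 0 y : Fin (n + 1) → ℝ) i t := fun y t => by
        rw [Fin.update_insertNth]
    refine stein_coord n (σ ^ 2) s0 (θ i) i f (fun x => h x i) _ f0 fi cf
      ((continuous_apply i).comp hh.continuous) cd ?_ ?_ (hint1 i) (hint2 i) ?_ ?_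
    · intro t y
      simp_rw [hf, Fin.prod_univ_succAbove _ i, Fin.insertNth_apply_same,
        Fin.insertNth_apply_succAbove]
      have h1 : HasDerivAt (fun t : ℝ => -(t - θ i) ^ 2 / (2 * σ ^ 2))
          (-((t - θ i) / σ ^ 2)) t := by
        have := ((((hasDerivAt_id t).sub_const (θ i)).pow 2).neg).div_const (2 * σ ^ 2)
        convert! this using 1
        simp
        field_simp
      have := ((h1.exp.const_mul ((2 * π * σ ^ 2) ^ (-(1 : ℝ) / 2)))).mul_const
        (∏ j, ((2 * π * σ ^ 2) ^ (-(1 : ℝ) / 2) *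
          Real.exp (-(y j - θ (i.succAbove j)) ^ 2 / (2 * σ ^ 2))))
      convert! this using 1
      ring
    · intro t y
      have := hder (i.insertNth 0 y) t
      simp only [dd]
      simpa only [← up] using this
    · intro y
      have := (hdecay i (i.insertNth 0 y)).mono_left le_sup_left
      simpa only [← up] using this
    · intro y
      have := (hdecay i (i.insertNth 0 y)).mono_left le_sup_right
      simpa only [← up] using this
  have iE : Integrable (fun x => ∑ i, (σ ^ 2 *
        (deriv (fun t => h (Function.update x i t) i) (x i) * f x)
        - h x i * (x i - θ i) * f x)) := integrable_finsetSum _ fun i _ => (key i).1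
  have zE : ∫ x, ∑ i, (σ ^ 2 *
        (deriv (fun t => h (Function.update x i t) i) (x i) * f x)
        - h x i * (x i - θ i) * f x) = 0 := by
    rw [integral_finsetSum _ fun i _ => (key i).1]
    exact Finset.sum_eq_zero fun i _ => (key i).2
  have eq : (fun x => S x * f x) = fun x => (∑ i, (h x i - θ i) ^ 2) * f x +
      2 * ∑ i, (σ ^ 2 *
        (deriv (fun t => h (Function.update x i t) i) (x i) * f x)
        - h x i * (x i - θ i) * f x) := by
    funext x
    rw [hS]
    simp only [Finset.mul_sum, Finset.sum_mul, ← Finset.sum_add_distrib,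
      ← Finset.sum_sub_distrib, add_mul, sub_mul]
    refine Finset.sum_congr rfl fun i _ => ?_
    ring
  have iE2 := iE.const_mul 2
  by_cases hI : Integrable (fun x => (∑ i, (h x i - θ i) ^ 2) * f x)
  · rw [eq, integral_add hI iE2, integral_const_mul, zE]
    simp
  · rw [integral_undef hI, integral_undef]
    rw [eq]
    intro hc
    apply hI
    refine (hc.sub iE2).congr (Eventually.of_forall fun x => ?_)
    simp
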